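/- Suppose that for every commutative Noetherian Gorenstein local ring S of depth 1 and every pair of nonzero finitely generated Tor-independent S-modules, the depth formula depth M + depth N = depth S + depth(M ⊗_S N) holds. Then for every commutative Noetherian Gorenstein local ring R of positive depth and every pair of nonzero finitely generated Tor-independent R-modules M, N, the depth formula holds over R. -/

import Mathlib

open CategoryTheory

universe u

/-- `Tor_i` over `R`, for bundled modules. -/
noncomputable def torM (R : Type u) [CommRing R] (i : ℕ) (M N : ModuleCat.{u} R) :
    ModuleCat.{u} R :=
  ((Tor (ModuleCat.{u} R) i).obj M).obj N

/-- `Tor_i^R(M, N)` for unbundled modules. -/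
noncomputable def torMod (R : Type u) [CommRing R] (i : ℕ)
    (M N : Type u) [AddCommGroup M] [Module R M] [AddCommGroup N] [Module R N] :
    ModuleCat.{u} R :=
  torM R i (ModuleCat.of R M) (ModuleCat.of R N)

/-- `M` and `N` are Tor-independent over `R`: `Tor_i^R(M,N) = 0` for all `i ≥ 1`. -/
def TorIndep (R : Type u) [CommRing R]
    (M N : Type u) [AddCommGroup M] [Module R M] [AddCommGroup N] [Module R N] : Prop :=
  ∀ i : ℕ, 1 ≤ i → Subsingleton (torMod R i M N)

/-- `Ext^i_R(M, N)` for unbundled modules. -/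
noncomputable def extMod (R : Type u) [CommRing R] (i : ℕ)
    (M N : Type u) [AddCommGroup M] [Module R M] [AddCommGroup N] [Module R N] :
    ModuleCat.{u} R :=
  ((Ext R (ModuleCat.{u} R) i).obj (Opposite.op (ModuleCat.of R M))).obj (ModuleCat.of R N)

/-- Depth of a module over a local ring: the least `i` with `Ext^i(k, M) ≠ 0`
(and `⊤` if all such Ext vanish, e.g. for the zero module). -/
noncomputable def eDepth (R : Type u) [CommRing R] [IsLocalRing R]
    (M : Type u) [AddCommGroup M] [Module R M] : ℕ∞ :=
  sInf {n : ℕ∞ | ∃ i : ℕ, n = (i : ℕ∞) ∧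
    Nontrivial (extMod R i (IsLocalRing.ResidueField R) M)}

/-- `IdLE R n M` : `M` admits an injective resolution of length `n`. -/
inductive IdLE (R : Type u) [CommRing R] : ℕ → ModuleCat.{u} R → Prop
  | zero (M : ModuleCat.{u} R) (h : Module.Injective R M) : IdLE R 0 M
  | succ (n : ℕ) (M C I : ModuleCat.{u} R) (hI : Module.Injective R I)
      (f : M ⟶ I) (g : I ⟶ C)
      (hf : Function.Injective f) (hfg : Function.Exact f g) (hg : Function.Surjective g)
      (hC : IdLE R n C) : IdLE R (n + 1) M

section ExtComparison

variable {R : Type u} [CommRing R]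

lemma subsingleton_extMod_iff (X Y : Type u) [AddCommGroup X] [Module R X] [AddCommGroup Y]
    [Module R Y] (i : ℕ) :
    Subsingleton (extMod R i X Y) ↔
      Subsingleton (Abelian.Ext (ModuleCat.of R X) (ModuleCat.of R Y) i) := by
  let P := ProjectiveResolution.of (ModuleCat.of R X)
  have h₁ : Subsingleton (extMod R i X Y) ↔
      ∀ f : P.complex.X i ⟶ ModuleCat.of R Y, P.complex.d (i + 1) i ≫ f = 0 →
        ∃ g : P.complex.X ((ComplexShape.up ℕ).prev i) ⟶ ModuleCat.of R Y,
          P.complex.d i ((ComplexShape.up ℕ).prev i) ≫ g = f := by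
    rw [← ModuleCat.isZero_iff_subsingleton, extMod,
      (P.isoExt i (ModuleCat.of R Y)).isZero_iff, ← HomologicalComplex.exactAt_iff_isZero_homology,
      HomologicalComplex.exactAt_iff' _ _ i (i + 1) rfl (by simp), ShortComplex.moduleCat_exact_iff]
    rfl
  rw [h₁]
  cases i with
  | zero =>
    rw [Abelian.Ext.addEquiv₀.subsingleton_congr]
    let p : P.complex.X 0 ⟶ ModuleCat.of R X := P.π.f 0
    have hp : Epi p := inferInstanceAs (Epi (P.π.f 0))
    have hdp : P.complex.d 1 0 ≫ p = 0 := P.complex_d_comp_π_f_zero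
    constructor
    · intro h
      refine ⟨fun a b ↦ ?_⟩
      obtain ⟨g, hg⟩ := h (p ≫ (a - b)) (by rw [← Category.assoc, hdp, Limits.zero_comp])
      rw [P.complex.shape _ _ (by simp), Limits.zero_comp] at hg
      exact sub_eq_zero.mp ((cancel_epi p).mp (by rw [← hg, Limits.comp_zero]))
    · intro h f hf
      refine ⟨0, ?_⟩
      rw [Limits.comp_zero]
      obtain ⟨l, hl⟩ := Limits.CokernelCofork.IsColimit.desc' P.isColimitCokernelCofork f hf
      have hl' : p ≫ (show ModuleCat.of R X ⟶ ModuleCat.of R Y from l) = f := hl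
      rw [← hl', Subsingleton.elim (show ModuleCat.of R X ⟶ ModuleCat.of R Y from l) 0,
        Limits.comp_zero]
  | succ i =>
    have hp : (ComplexShape.up ℕ).prev (i + 1) = i := by simp
    rw [hp]
    constructor
    · intro h
      refine ⟨fun a b ↦ ?_⟩
      rw [← sub_eq_zero]
      obtain ⟨f, hf, hfe⟩ := P.extMk_surjective (a - b) (i + 2) rfl
      rw [← hfe, P.extMk_eq_zero_iff f (i + 2) rfl hf i rfl]
      exact h f hf
    · intro h f hf
      rw [← P.extMk_eq_zero_iff f (i + 2) rfl hf i rfl]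
      exact Subsingleton.elim _ _

end ExtComparison

section Depth

variable {R : Type u} [CommRing R] [IsLocalRing R]

lemma natCast_le_eDepth_iff (M : Type u) [AddCommGroup M] [Module R M] (n : ℕ) :
    (n : ℕ∞) ≤ eDepth R M ↔ ∀ i < n, Subsingleton
      (Abelian.Ext (ModuleCat.of R (IsLocalRing.ResidueField R)) (ModuleCat.of R M) i) := by
  simp only [eDepth, le_sInf_iff, Set.mem_ofPred_eq, forall_exists_index, and_imp]
  constructor
  · intro h i hi
    rw [← subsingleton_extMod_iff, ← not_nontrivial_iff_subsingleton]
    intro hn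
    exact absurd (h _ i rfl hn) (by simpa using hi)
  · rintro h _ i rfl hn
    by_contra hlt
    rw [← not_subsingleton_iff_nontrivial, subsingleton_extMod_iff] at hn
    exact hn (h i (by simpa using hlt))

variable {A B C : Type u} [AddCommGroup A] [Module R A] [AddCommGroup B] [Module R B]
  [AddCommGroup C] [Module R C]

lemma eDepth_congr (e : A ≃ₗ[R] B) : eDepth R A = eDepth R B := by
  have key (i : ℕ) : Subsingleton (Abelian.Ext (ModuleCat.of R (IsLocalRing.ResidueField R))
        (ModuleCat.of R A) i) ↔
      Subsingleton (Abelian.Ext (ModuleCat.of R (IsLocalRing.ResidueField R))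
        (ModuleCat.of R B) i) := by
    rw [← subsingleton_extMod_iff, ← subsingleton_extMod_iff]
    exact (((Ext R (ModuleCat.{u} R) i).obj (Opposite.op (ModuleCat.of R
      (IsLocalRing.ResidueField R)))).mapIso e.toModuleIso).toLinearEquiv.toEquiv.subsingleton_congr
  refine le_antisymm ?_ ?_ <;> refine ENat.forall_natCast_le_iff_le.mp fun n ↦ ?_ <;>
    simp only [natCast_le_eDepth_iff, key, imp_self]

lemma eDepth_eq_top_of_subsingleton [Subsingleton A] : eDepth R A = ⊤ := by
  rw [← top_le_iff]
  refine ENat.forall_natCast_le_iff_le.mp fun n _ ↦ (natCast_le_eDepth_iff A n).mpr fun i _ ↦ ?_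
  refine subsingleton_of_forall_eq 0 fun x ↦ ?_
  rw [← x.comp_mk₀_id, (ModuleCat.isZero_of_subsingleton (ModuleCat.of R A)).eq_of_src (𝟙 _) 0,
    Abelian.Ext.mk₀_zero, Abelian.Ext.comp_zero]

/-- The short complex attached to an exact pair of linear maps. -/
abbrev shortComplexOfExact {f : A →ₗ[R] B} {g : B →ₗ[R] C} (hfg : Function.Exact f g) :
    ShortComplex (ModuleCat.{u} R) :=
  ModuleCat.shortComplexOfCompEqZero f g hfg.linearMap_comp_eq_zero

variable {f : A →ₗ[R] B} {g : B →ₗ[R] C} (hf : Function.Injective f) (hfg : Function.Exact f g)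
  (hg : Function.Surjective g) {n : ℕ}

include hf hfg hg

lemma natCast_le_eDepth_middle (hA : n ≤ eDepth R A) (hC : n ≤ eDepth R C) :
    n ≤ eDepth R B := by
  rw [natCast_le_eDepth_iff] at *
  intro i hi
  have hS := ModuleCat.shortComplex_shortExact (shortComplexOfExact hfg) hfg hf hg
  have h1 := hA i hi
  have h2 := hC i hi
  refine subsingleton_of_forall_eq 0 fun x ↦ ?_
  obtain ⟨y, rfl⟩ := Abelian.Ext.covariant_sequence_exact₂ _ hS x (h2.elim _ _)
  rw [h1.elim y 0, Abelian.Ext.zero_comp]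

lemma natCast_succ_le_eDepth_left (hB : (n + 1 : ℕ) ≤ eDepth R B) (hC : n ≤ eDepth R C) :
    (n + 1 : ℕ) ≤ eDepth R A := by
  rw [natCast_le_eDepth_iff] at *
  intro i hi
  have hS := ModuleCat.shortComplex_shortExact (shortComplexOfExact hfg) hfg hf hg
  have h1 := hB i hi
  refine subsingleton_of_forall_eq 0 fun x ↦ ?_
  cases i with
  | zero =>
    have hm : Mono (shortComplexOfExact hfg).f := hS.mono_f
    have h2 : Subsingleton (ModuleCat.of R (IsLocalRing.ResidueField R) ⟶ ModuleCat.of R B) :=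
      Abelian.Ext.addEquiv₀.subsingleton_congr.mp h1
    rw [← Abelian.Ext.addEquiv₀.map_eq_zero_iff,
      ← cancel_mono (shortComplexOfExact hfg).f]
    exact h2.elim _ _
  | succ i =>
    have h2 := hC i (by omega)
    obtain ⟨y, rfl⟩ := Abelian.Ext.covariant_sequence_exact₁ _ hS x (h1.elim _ _) rfl
    rw [h2.elim y 0, Abelian.Ext.zero_comp]

lemma natCast_le_eDepth_right (hB : n ≤ eDepth R B) (hA : (n + 1 : ℕ) ≤ eDepth R A) :
    n ≤ eDepth R C := by
  rw [natCast_le_eDepth_iff] at *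
  intro i hi
  have hS := ModuleCat.shortComplex_shortExact (shortComplexOfExact hfg) hfg hf hg
  have h1 := hB i hi
  have h2 := hA (i + 1) (by omega)
  refine subsingleton_of_forall_eq 0 fun x ↦ ?_
  obtain ⟨y, rfl⟩ := Abelian.Ext.covariant_sequence_exact₃ _ hS x rfl (h2.elim _ _)
  rw [h1.elim y 0, Abelian.Ext.zero_comp]

end Depth

section FreeDepth

variable {R : Type u} [CommRing R] [IsLocalRing R] {N : Type u} [AddCommGroup N] [Module R N]

lemma natCast_le_eDepth_pi {n : ℕ} (hN : n ≤ eDepth R N) (m : ℕ) :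
    n ≤ eDepth R (Fin m → N) := by
  induction m with
  | zero => rw [eDepth_eq_top_of_subsingleton]; exact le_top
  | succ m ih =>
    refine natCast_le_eDepth_middle (f := LinearMap.single R (fun _ : Fin (m + 1) ↦ N) 0)
      (g := LinearMap.pi fun i ↦ LinearMap.proj i.succ)
      (Pi.single_injective (M := fun _ : Fin (m + 1) ↦ N) 0) ?_ ?_ hN ih
    · intro v
      constructor
      · intro hv
        refine ⟨v 0, funext fun i ↦ ?_⟩
        cases i using Fin.cases with
        | zero => simp
        | succ i => simpa using (congrFun hv i).symm
      · rintro ⟨y, rfl⟩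
        ext i
        simp
    · exact fun v ↦ ⟨Fin.cons 0 v, by ext i; simp⟩

lemma natCast_le_eDepth_free_tensor {n : ℕ} (hN : n ≤ eDepth R N) (m : ℕ) :
    n ≤ eDepth R (TensorProduct R (Fin m → R) N) := by
  rw [eDepth_congr (TensorProduct.comm R (Fin m → R) N ≪≫ₗ
    TensorProduct.piScalarRight R R N (Fin m))]
  exact natCast_le_eDepth_pi hN m

end FreeDepth

section RegularSequences

open RingTheory.Sequence

variable {R : Type u} [CommRing R] [IsLocalRing R] [IsNoetherianRing R]
  (M : Type u) [AddCommGroup M] [Module R M] [Module.Finite R M] [Nontrivial M]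

lemma natCast_le_eDepth_iff_exists_isWeaklyRegular (n : ℕ) :
    n ≤ eDepth R M ↔ ∃ rs : List R, rs.length = n ∧
      (∀ r ∈ rs, r ∈ IsLocalRing.maximalIdeal R) ∧ IsWeaklyRegular M rs := by
  rw [natCast_le_eDepth_iff]
  have hlt : IsLocalRing.maximalIdeal R • (⊤ : Submodule R M) < ⊤ :=
    lt_top_iff_ne_top.mpr (Submodule.top_ne_ideal_smul_of_le_jacobson_annihilator
      (IsLocalRing.maximalIdeal_le_jacobson _)).symm
  have hfin : Module.Finite R (IsLocalRing.ResidueField R) :=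
    inferInstanceAs (Module.Finite R (R ⧸ IsLocalRing.maximalIdeal R))
  have hsupp : Module.support R (ModuleCat.of R (IsLocalRing.ResidueField R)) =
      PrimeSpectrum.zeroLocus (IsLocalRing.maximalIdeal R) := by
    change Module.support R (R ⧸ IsLocalRing.maximalIdeal R) = _
    rw [Module.support_eq_zeroLocus, Ideal.annihilator_quotient]
  constructor
  · intro h
    obtain ⟨rs, h1, h2, h3⟩ := ModuleCat.exists_isRegular_of_exists_subsingleton_ext
      (IsLocalRing.maximalIdeal R) n (ModuleCat.of R M) hlt
      (ModuleCat.of R (IsLocalRing.ResidueField R)) hsupp h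
    exact ⟨rs, h1, h2, h3.toIsWeaklyRegular⟩
  · rintro ⟨rs, rfl, h2, h3⟩
    exact ModuleCat.subsingleton_ext_of_exists_isRegular (IsLocalRing.maximalIdeal R)
      (ModuleCat.of R (IsLocalRing.ResidueField R)) hsupp.le (ModuleCat.of R M) hlt rs h2
      (IsRegular.of_isWeaklyRegular_of_mem_maximalIdeal _ h2 h3)

lemma eDepth_ne_top : eDepth R M ≠ ⊤ := by
  intro htop
  obtain ⟨d, hd⟩ : ∃ d : ℕ, ringKrullDim R = d := by
    obtain ⟨a, ha⟩ := WithBot.ne_bot_iff_exists.mp (ringKrullDim_ne_bot (R := R))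
    obtain ⟨d, rfl⟩ := ENat.ne_top_iff_exists.mp (show a ≠ ⊤ by
      rintro rfl
      exact ringKrullDim_ne_top (R := R) ha.symm)
    exact ⟨d, ha.symm⟩
  obtain ⟨rs, h1, h2, h3⟩ := (natCast_le_eDepth_iff_exists_isWeaklyRegular M (d + 1)).mp
    (htop ▸ le_top)
  have hreg := IsRegular.of_isWeaklyRegular_of_mem_maximalIdeal M h2 h3
  have hdim := Module.supportDim_add_length_eq_supportDim_of_isRegular rs hreg
  have hle := hdim ▸ Module.supportDim_le_ringKrullDim R M
  have hnt : Nontrivial (M ⧸ Ideal.ofList rs • (⊤ : Submodule R M)) :=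
    Submodule.Quotient.nontrivial_iff.mpr hreg.top_ne_smul.symm
  obtain ⟨a, ha⟩ := WithBot.ne_bot_iff_exists.mp
    ((Module.supportDim_ne_bot_iff_nontrivial R _).mpr hnt)
  rw [← ha, hd, h1] at hle
  have hle' : a + (d + 1 : ℕ) ≤ (d : ℕ∞) := by exact_mod_cast hle
  have := le_trans le_add_self hle'
  norm_cast at this
  omega

variable {M}

lemma one_le_eDepth_iff_exists_isSMulRegular :
    1 ≤ eDepth R M ↔ ∃ x ∈ IsLocalRing.maximalIdeal R, IsSMulRegular M x := by
  rw [← Nat.cast_one, natCast_le_eDepth_iff_exists_isWeaklyRegular]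
  constructor
  · rintro ⟨rs, h1, h2, h3⟩
    obtain ⟨x, rfl⟩ := List.length_eq_one_iff.mp h1
    exact ⟨x, h2 x (by simp), (isWeaklyRegular_singleton_iff M x).mp h3⟩
  · rintro ⟨x, h1, h2⟩
    exact ⟨[x], rfl, by simpa using h1, (isWeaklyRegular_singleton_iff M x).mpr h2⟩

lemma natCast_le_eDepth_quotSMulTop_iff {x : R} (hx : x ∈ IsLocalRing.maximalIdeal R)
    (hreg : IsSMulRegular M x) (n : ℕ) :
    n ≤ eDepth R (QuotSMulTop x M) ↔ (n + 1 : ℕ) ≤ eDepth R M := by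
  constructor
  · intro h
    have : Nontrivial (QuotSMulTop x M) := nontrivial_quotSMulTop_of_mem_maximalIdeal M hx
    obtain ⟨rs, rfl, h2, h3⟩ := (natCast_le_eDepth_iff_exists_isWeaklyRegular _ n).mp h
    exact (natCast_le_eDepth_iff_exists_isWeaklyRegular _ _).mpr ⟨x :: rs, rfl,
      List.forall_mem_cons.mpr ⟨hx, h2⟩, (isWeaklyRegular_cons_iff M x rs).mpr ⟨hreg, h3⟩⟩
  · intro h
    exact natCast_le_eDepth_right (f := LinearMap.lsmul R M x) hreg
      (LinearMap.exact_lsmul_mkQ_smul_top M x) (Submodule.mkQ_surjective _)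
      (le_trans (by norm_cast; omega) h) h

variable (M) in
lemma eDepth_of_surjective_algebraMap {S : Type u} [CommRing S] [IsLocalRing S]
    [IsNoetherianRing S] [Algebra R S] (hS : Function.Surjective (algebraMap R S))
    [Module S M] [IsScalarTower R S M] : eDepth S M = eDepth R M := by
  have := Module.Finite.of_restrictScalars_finite R S M
  have hloc : IsLocalHom (algebraMap R S) := IsLocalHom.of_surjective _ hS
  have key (n : ℕ) : n ≤ eDepth S M ↔ n ≤ eDepth R M := by
    simp only [natCast_le_eDepth_iff_exists_isWeaklyRegular]
    constructor
    · rintro ⟨rs, rfl, h2, h3⟩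
      obtain ⟨rs, rfl⟩ := List.map_surjective_iff.mpr hS rs
      refine ⟨rs, by simp, fun r hr ↦ ?_, (isWeaklyRegular_map_algebraMap_iff S M rs).mp h3⟩
      have := h2 _ (List.mem_map_of_mem hr)
      simpa using this
    · rintro ⟨rs, rfl, h2, h3⟩
      refine ⟨rs.map (algebraMap R S), by simp, fun r hr ↦ ?_,
        (isWeaklyRegular_map_algebraMap_iff S M rs).mpr h3⟩
      obtain ⟨r', hr', rfl⟩ := List.mem_map.mp hr
      simpa using h2 r' hr'
  exact le_antisymm (ENat.forall_natCast_le_iff_le.mp fun n ↦ (key n).mp)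
    (ENat.forall_natCast_le_iff_le.mp fun n ↦ (key n).mpr)

end RegularSequences

section TorBasic

variable {R : Type u} [CommRing R]

lemma subsingleton_torMod_succ_iff (M : Type u) [AddCommGroup M] [Module R M] {N : Type u}
    [AddCommGroup N] [Module R N] (P : ProjectiveResolution (ModuleCat.of R N)) (i : ℕ) :
    Subsingleton (torMod R (i + 1) M N) ↔
      Function.Exact ((P.complex.d (i + 2) (i + 1)).hom.lTensor M)
        ((P.complex.d (i + 1) i).hom.lTensor M) := by
  rw [← ModuleCat.isZero_iff_subsingleton, torMod, torM, Tor_obj,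
    ((P.isoLeftDerivedObj ((MonoidalCategory.tensoringLeft _).obj (ModuleCat.of R M))
      (i + 1))).isZero_iff]
  change Limits.IsZero (HomologicalComplex.homology _ _) ↔ _
  rw [← HomologicalComplex.exactAt_iff_isZero_homology,
    HomologicalComplex.exactAt_iff' _ (i + 2) (i + 1) i (by simp) (by simp),
    ShortComplex.ShortExact.moduleCat_exact_iff_function_exact]
  rfl

section Augmentation

variable {X : ModuleCat.{u} R} (P : ProjectiveResolution X)

/-- The augmentation of a projective resolution, as a map to the resolved module. -/
noncomputable def resolutionAugmentation : P.complex.X 0 ⟶ X := P.π.f 0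

lemma d_comp_resolutionAugmentation : P.complex.d 1 0 ≫ resolutionAugmentation P = 0 :=
  P.complex_d_comp_π_f_zero

lemma exact_resolutionAugmentation :
    Function.Exact (P.complex.d 1 0).hom (resolutionAugmentation P).hom :=
  (ShortComplex.ShortExact.moduleCat_exact_iff_function_exact _).mp P.exact₀

lemma resolutionAugmentation_surjective : Function.Surjective (resolutionAugmentation P).hom :=
  (ModuleCat.epi_iff_surjective _).mp (inferInstanceAs (Epi (P.π.f 0)))

lemma exact_resolution_d (n : ℕ) :
    Function.Exact (P.complex.d (n + 2) (n + 1)).hom (P.complex.d (n + 1) n).hom :=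
  (ShortComplex.ShortExact.moduleCat_exact_iff_function_exact _).mp (P.exact_succ n)

end Augmentation

variable {A B C : Type u} [AddCommGroup A] [Module R A] [AddCommGroup B] [Module R B]
  [AddCommGroup C] [Module R C]

/-- The complex obtained by splicing a projective resolution of `A` with a map `A → B`. -/
noncomputable abbrev spliceComplex (f : A →ₗ[R] B)
    (P : ProjectiveResolution (ModuleCat.of R A)) : ChainComplex (ModuleCat.{u} R) ℕ :=
  P.complex.augment (resolutionAugmentation P ≫ ModuleCat.ofHom f)
    (by rw [← Category.assoc, d_comp_resolutionAugmentation, Limits.zero_comp])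

lemma spliceComplex_exact_one {f : A →ₗ[R] B} (hf : Function.Injective f)
    (P : ProjectiveResolution (ModuleCat.of R A)) :
    Function.Exact (P.complex.d 1 0).hom (f ∘ₗ (resolutionAugmentation P).hom) := by
  intro x
  rw [LinearMap.comp_apply, map_eq_zero_iff f hf]
  exact exact_resolutionAugmentation P x

lemma spliceComplex_exact_zero {f : A →ₗ[R] B} {g : B →ₗ[R] C} (hfg : Function.Exact f g)
    (P : ProjectiveResolution (ModuleCat.of R A)) :
    Function.Exact (f ∘ₗ (resolutionAugmentation P).hom) g := by
  intro x
  rw [hfg x, LinearMap.coe_comp, Set.range_comp, (resolutionAugmentation_surjective P).range_eq,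
    Set.image_univ]

/-- Splicing a projective resolution of the kernel of a surjection from a projective module. -/
noncomputable def spliceResolution {f : A →ₗ[R] B} {g : B →ₗ[R] C} (hf : Function.Injective f)
    (hfg : Function.Exact f g) (hg : Function.Surjective g) [Module.Projective R B]
    (P : ProjectiveResolution (ModuleCat.of R A)) : ProjectiveResolution (ModuleCat.of R C) where
  complex := spliceComplex f P
  projective n := by
    cases n with
    | zero => exact inferInstanceAs (Projective (ModuleCat.of R B))
    | succ n => exact P.projective n
  π := (ChainComplex.toSingle₀Equiv _ _).symm ⟨ModuleCat.ofHom g, by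
    ext x
    exact (spliceComplex_exact_zero hfg P).apply_apply_eq_zero x⟩
  quasiIso := ⟨fun n => by
    cases n with
    | zero =>
      rw [ChainComplex.quasiIsoAt₀_iff, ShortComplex.quasiIso_iff_of_zeros']
      · have hS : (ModuleCat.shortComplexOfCompEqZero _ _
            (spliceComplex_exact_zero hfg P).linearMap_comp_eq_zero).Exact ∧
            Epi (ModuleCat.ofHom g) :=
          ⟨(ShortComplex.ShortExact.moduleCat_exact_iff_function_exact _).mpr
            (spliceComplex_exact_zero hfg P), (ModuleCat.epi_iff_surjective _).mpr hg⟩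
        refine (ShortComplex.exact_and_epi_g_iff_of_iso ?_).2 hS
        exact ShortComplex.isoMk (Iso.refl _) (Iso.refl _) (Iso.refl _)
          (by simp; rfl) (by simp; rfl)
      all_goals rfl
    | succ n =>
      rw [quasiIsoAt_iff_exactAt']
      · rw [HomologicalComplex.exactAt_iff' _ (n + 1 + 1) (n + 1) n (by simp) (by simp),
          ShortComplex.ShortExact.moduleCat_exact_iff_function_exact]
        cases n with
        | zero => exact spliceComplex_exact_one hf P
        | succ n => exact exact_resolution_d P n
      · apply ChainComplex.exactAt_succ_single_obj⟩

variable (M : Type u) [AddCommGroup M] [Module R M]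
variable {f : A →ₗ[R] B} {g : B →ₗ[R] C} (hf : Function.Injective f) (hfg : Function.Exact f g)
  (hg : Function.Surjective g) [Module.Projective R B]

include hf hfg hg

lemma subsingleton_torMod_add_two_iff (i : ℕ) :
    Subsingleton (torMod R (i + 2) M C) ↔ Subsingleton (torMod R (i + 1) M A) := by
  let P := ProjectiveResolution.of (ModuleCat.of R A)
  rw [subsingleton_torMod_succ_iff M (spliceResolution hf hfg hg P),
    subsingleton_torMod_succ_iff M P]
  cases i <;> rfl

lemma subsingleton_torMod_one_iff :
    Subsingleton (torMod R 1 M C) ↔ Function.Injective (f.lTensor M) := by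
  let P := ProjectiveResolution.of (ModuleCat.of R A)
  let a := (resolutionAugmentation P).hom
  have h₁ := lTensor_exact M (exact_resolutionAugmentation P) (resolutionAugmentation_surjective P)
  have h₂ := LinearMap.lTensor_surjective M (resolutionAugmentation_surjective P)
  rw [subsingleton_torMod_succ_iff M (spliceResolution hf hfg hg P)]
  change Function.Exact ((P.complex.d 1 0).hom.lTensor M) ((f ∘ₗ a).lTensor M) ↔ _
  rw [LinearMap.lTensor_comp]
  constructor
  · intro h
    rw [injective_iff_map_eq_zero]
    intro z hz
    obtain ⟨w, rfl⟩ := h₂ z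
    exact (h₁ w).mpr ((h w).mp hz)
  · intro h z
    rw [LinearMap.comp_apply, map_eq_zero_iff _ h]
    exact h₁ z

lemma torIndep_iff :
    TorIndep R M C ↔ Function.Injective (f.lTensor M) ∧ TorIndep R M A := by
  rw [← subsingleton_torMod_one_iff M hf hfg hg]
  constructor
  · refine fun h ↦ ⟨h 1 le_rfl, fun i hi ↦ ?_⟩
    obtain ⟨i, rfl⟩ := Nat.exists_eq_add_of_le' hi
    exact (subsingleton_torMod_add_two_iff M hf hfg hg i).mp (h _ (by omega))
  · rintro ⟨h₁, h⟩ i hi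
    match i, hi with
    | 1, _ => exact h₁
    | i + 2, _ => exact (subsingleton_torMod_add_two_iff M hf hfg hg i).mpr (h _ (by omega))

end TorBasic

section TorSymmetry

variable {R : Type u} [CommRing R]

/-- A diagram chase: for short exact sequences `0 → K → F → M → 0` and `0 → L → G → N → 0`
with `F` and `G` flat, vanishing of `Tor₁` can be tested on either variable. -/
lemma rTensor_injective_of_lTensor_injective {K F M L G N : Type u}
    [AddCommGroup K] [Module R K] [AddCommGroup F] [Module R F] [AddCommGroup M] [Module R M]
    [AddCommGroup L] [Module R L] [AddCommGroup G] [Module R G] [AddCommGroup N] [Module R N]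
    [Module.Flat R F] [Module.Flat R G]
    {k : K →ₗ[R] F} {p : F →ₗ[R] M} (hk : Function.Injective k) (hkp : Function.Exact k p)
    (hp : Function.Surjective p)
    {l : L →ₗ[R] G} {q : G →ₗ[R] N} (hlq : Function.Exact l q)
    (hq : Function.Surjective q) (h : Function.Injective (l.lTensor M)) :
    Function.Injective (k.rTensor N) := by
  rw [injective_iff_map_eq_zero]
  intro z hz
  obtain ⟨y, rfl⟩ := LinearMap.lTensor_surjective K hq z
  obtain ⟨w, hw⟩ := (lTensor_exact F hlq hq (k.rTensor G y)).mp (by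
    rwa [← LinearMap.comp_apply, LinearMap.lTensor_comp_rTensor,
      ← LinearMap.rTensor_comp_lTensor])
  have hw0 : p.rTensor L w = 0 := by
    apply h
    rw [← LinearMap.comp_apply, LinearMap.lTensor_comp_rTensor, ← LinearMap.rTensor_comp_lTensor,
      LinearMap.comp_apply, hw, map_zero, ← LinearMap.comp_apply, ← LinearMap.rTensor_comp,
      hkp.linearMap_comp_eq_zero, LinearMap.rTensor_zero, LinearMap.zero_apply]
  obtain ⟨v, rfl⟩ := (rTensor_exact L hkp hp w).mp hw0
  have hv : l.lTensor K v = y := by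
    apply Module.Flat.rTensor_preserves_injective_linearMap (M := G) k hk
    rw [← hw, ← LinearMap.comp_apply, ← LinearMap.comp_apply, LinearMap.lTensor_comp_rTensor,
      LinearMap.rTensor_comp_lTensor]
  rw [← hv]
  exact (lTensor_exact K hlq hq _).mpr ⟨v, rfl⟩

/-- Every module has a presentation by a free module, within the same universe. -/
lemma exists_free_presentation (M : Type u) [AddCommGroup M] [Module R M] :
    ∃ (K F : Type u) (_ : AddCommGroup K) (_ : Module R K) (_ : AddCommGroup F) (_ : Module R F)
      (k : K →ₗ[R] F) (p : F →ₗ[R] M), Module.Free R F ∧ Function.Injective k ∧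
        Function.Exact k p ∧ Function.Surjective p :=
  let p := Finsupp.linearCombination R (id : M → M)
  ⟨LinearMap.ker p, M →₀ R, inferInstance, inferInstance, inferInstance, inferInstance,
    (LinearMap.ker p).subtype, p, inferInstance, Subtype.val_injective,
    LinearMap.exact_subtype_ker_map p, Finsupp.linearCombination_id_surjective R M⟩

variable {K F M : Type u}
    [AddCommGroup K] [Module R K] [AddCommGroup F] [Module R F] [AddCommGroup M] [Module R M]
    [Module.Flat R F] {k : K →ₗ[R] F} {p : F →ₗ[R] M} (hk : Function.Injective k)
    (hkp : Function.Exact k p) (hp : Function.Surjective p)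

include hk hkp hp

lemma rTensor_injective_of_subsingleton_torMod_one {N : Type u} [AddCommGroup N] [Module R N]
    (h : Subsingleton (torMod R 1 M N)) : Function.Injective (k.rTensor N) := by
  obtain ⟨L, G, _, _, _, _, l, q, hG, hl, hlq, hq⟩ := exists_free_presentation (R := R) N
  exact rTensor_injective_of_lTensor_injective hk hkp hp hlq hq
    ((subsingleton_torMod_one_iff M hl hlq hq).mp h)

lemma TorIndep.syzygy_left {N : Type u} [AddCommGroup N] [Module R N] (h : TorIndep R M N) :
    TorIndep R K N := by
  intro i hi
  obtain ⟨i, rfl⟩ := Nat.exists_eq_add_of_le' hi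
  clear hi
  induction i generalizing N with
  | zero =>
    obtain ⟨L, G, _, _, _, _, l, q, hG, hl, hlq, hq⟩ := exists_free_presentation (R := R) N
    have hL := ((torIndep_iff M hl hlq hq).mp h).2
    rw [subsingleton_torMod_one_iff K hl hlq hq]
    have h₁ : Function.Injective (k.rTensor L) :=
      rTensor_injective_of_subsingleton_torMod_one hk hkp hp (hL 1 le_rfl)
    have h₂ := Module.Flat.lTensor_preserves_injective_linearMap (M := F) l hl
    have h₃ := h₂.comp h₁
    rw [← LinearMap.coe_comp, LinearMap.lTensor_comp_rTensor, ← LinearMap.rTensor_comp_lTensor,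
      LinearMap.coe_comp] at h₃
    exact h₃.of_comp
  | succ i ih =>
    obtain ⟨L, G, _, _, _, _, l, q, hG, hl, hlq, hq⟩ := exists_free_presentation (R := R) N
    rw [subsingleton_torMod_add_two_iff K hl hlq hq]
    exact ih ((torIndep_iff M hl hlq hq).mp h).2

omit hk hkp hp in
lemma TorIndep.symm {N : Type u} [AddCommGroup N] [Module R N] (h : TorIndep R M N) :
    TorIndep R N M := by
  intro i hi
  obtain ⟨i, rfl⟩ := Nat.exists_eq_add_of_le' hi
  clear hi
  induction i generalizing M with
  | zero =>
    obtain ⟨K, F, _, _, _, _, k, p, hF, hk, hkp, hp⟩ := exists_free_presentation (R := R) M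
    rw [subsingleton_torMod_one_iff N hk hkp hp, LinearMap.lTensor_inj_iff_rTensor_inj]
    exact rTensor_injective_of_subsingleton_torMod_one hk hkp hp (h 1 le_rfl)
  | succ i ih =>
    obtain ⟨K, F, _, _, _, _, k, p, hF, hk, hkp, hp⟩ := exists_free_presentation (R := R) M
    rw [subsingleton_torMod_add_two_iff N hk hkp hp]
    exact ih (h.syzygy_left hk hkp hp)

end TorSymmetry

section QuotientBaseChange

open TensorProduct

variable {R : Type u} [CommRing R] {x : R}

variable {A B C : Type u} [AddCommGroup A] [Module R A] [AddCommGroup B] [Module R B]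
  [AddCommGroup C] [Module R C]

lemma exists_one_tmul_eq (z : (R ⧸ Ideal.span {x}) ⊗[R] A) :
    ∃ a : A, (1 : R ⧸ Ideal.span {x}) ⊗ₜ[R] a = z := by
  obtain ⟨a, ha⟩ := Submodule.mkQ_surjective _ (quotTensorEquivQuotSMul A (Ideal.span {x}) z)
  refine ⟨a, ?_⟩
  rw [← quotTensorEquivQuotSMul_symm_mk (Ideal.span {x}) a]
  rw [LinearEquiv.symm_apply_eq]
  exact ha

lemma one_tmul_eq_zero_iff (a : A) :
    (1 : R ⧸ Ideal.span {x}) ⊗ₜ[R] a = 0 ↔ ∃ b : A, x • b = a := by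
  rw [← quotTensorEquivQuotSMul_symm_mk (Ideal.span {x}) a, LinearEquiv.map_eq_zero_iff,
    Submodule.Quotient.mk_eq_zero, Submodule.ideal_span_singleton_smul,
    Submodule.mem_smul_pointwise_iff_exists]
  simp

lemma baseChange_quotient_injective {f : A →ₗ[R] B} {g : B →ₗ[R] C} (hf : Function.Injective f)
    (hfg : Function.Exact f g) (hx : IsSMulRegular C x) :
    Function.Injective (f.baseChange (R ⧸ Ideal.span {x})) := by
  rw [injective_iff_map_eq_zero]
  intro z hz
  obtain ⟨a, rfl⟩ := exists_one_tmul_eq z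
  rw [LinearMap.baseChange_tmul, one_tmul_eq_zero_iff] at hz
  obtain ⟨b, hb⟩ := hz
  have hgb : g b = 0 := hx (by
    simp only [smul_zero]
    rw [← map_smul, hb, hfg.apply_apply_eq_zero])
  obtain ⟨a', rfl⟩ := (hfg b).mp hgb
  rw [one_tmul_eq_zero_iff]
  exact ⟨a', hf (by rw [map_smul, hb])⟩

lemma isSMulRegular_of_flat [Module.Flat R A] (hx : IsSMulRegular R x) : IsSMulRegular A x :=
  Module.Flat.isSMulRegular_of_isRegular (isLeftRegular_iff_isRegular.mp hx)

lemma lTensor_baseChange_injective {S : Type u} [CommRing S] [Algebra R S]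
    (M : Type u) [AddCommGroup M] [Module R M] (f : A →ₗ[R] B)
    (h : Function.Injective ((f.lTensor M).baseChange S)) :
    Function.Injective ((f.baseChange S).lTensor (S ⊗[R] M)) := by
  have key : (f.baseChange S).lTensor (S ⊗[R] M) ∘ₗ
      (AlgebraTensorModule.distribBaseChange R S M A).toLinearMap =
      (AlgebraTensorModule.distribBaseChange R S M B).toLinearMap ∘ₗ
        (f.lTensor M).baseChange S := by
    ext m a
    simp
  have h' := (AlgebraTensorModule.distribBaseChange R S M B).injective.comp h
  rw [← LinearEquiv.coe_toLinearMap, ← LinearMap.coe_comp, ← key, LinearMap.coe_comp] at h'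
  exact (Function.Injective.of_comp_iff' _
    (AlgebraTensorModule.distribBaseChange R S M A).bijective).mp h'

lemma TorIndep.baseChange_quotient {M N : Type u} [AddCommGroup M] [Module R M]
    [AddCommGroup N] [Module R N] (h : TorIndep R M N) (hR : IsSMulRegular R x)
    (hM : IsSMulRegular M x) (hN : IsSMulRegular N x) (hMN : IsSMulRegular (M ⊗[R] N) x) :
    TorIndep (R ⧸ Ideal.span {x}) ((R ⧸ Ideal.span {x}) ⊗[R] M)
      ((R ⧸ Ideal.span {x}) ⊗[R] N) := by
  intro i hi
  obtain ⟨i, rfl⟩ := Nat.exists_eq_add_of_le' hi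
  clear hi
  induction i generalizing N with
  | zero =>
    obtain ⟨K, F, _, _, _, _, k, p, hF, hk, hkp, hp⟩ := exists_free_presentation (R := R) N
    rw [subsingleton_torMod_one_iff (g := p.baseChange (R ⧸ Ideal.span {x})) _
      (baseChange_quotient_injective hk hkp hN)
      (lTensor_exact _ hkp hp) (LinearMap.lTensor_surjective _ hp)]
    exact lTensor_baseChange_injective M k (baseChange_quotient_injective
      ((torIndep_iff M hk hkp hp).mp h).1 (lTensor_exact _ hkp hp) hMN)
  | succ i ih =>
    obtain ⟨K, F, _, _, _, _, k, p, hF, hk, hkp, hp⟩ := exists_free_presentation (R := R) N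
    obtain ⟨h₁, h₂⟩ := (torIndep_iff M hk hkp hp).mp h
    rw [subsingleton_torMod_add_two_iff (g := p.baseChange (R ⧸ Ideal.span {x})) _
      (baseChange_quotient_injective hk hkp hN)
      (lTensor_exact _ hkp hp) (LinearMap.lTensor_surjective _ hp)]
    exact ih h₂ ((isSMulRegular_of_flat hR).of_injective k hk)
      ((hM.rTensor F).of_injective (k.lTensor M) h₁)

end QuotientBaseChange

section InjectiveDimension

variable {R : Type u} [CommRing R]

lemma IdLE.hasInjectiveDimensionLT {n : ℕ} {M : ModuleCat.{u} R} (h : IdLE R n M) :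
    HasInjectiveDimensionLT M (n + 1) := by
  induction h with
  | zero M h =>
    have := (Module.injective_iff_injective_object R M).mp h
    infer_instance
  | succ n M C I hI f g hf hfg hg hC ih =>
    have := (Module.injective_iff_injective_object R I).mp hI
    have hS := ModuleCat.shortComplex_shortExact (ModuleCat.shortComplexOfCompEqZero f.hom g.hom
      (Function.Exact.linearMap_comp_eq_zero hfg)) hfg hf hg
    exact (hS.hasInjectiveDimensionLT_X₃_iff n this).mp ih

lemma IdLE.of_hasInjectiveDimensionLT {n : ℕ} {M : ModuleCat.{u} R}
    (h : HasInjectiveDimensionLT M (n + 1)) : IdLE R n M := by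
  induction n generalizing M with
  | zero =>
    exact .zero M ((Module.injective_iff_injective_object R M).mpr
      (injective_iff_hasInjectiveDimensionLT_one.mpr h))
  | succ n ih =>
    let f := Injective.ι M
    have hf : Function.Injective f.hom := (ModuleCat.mono_iff_injective _).mp inferInstance
    let g := (LinearMap.range f.hom).mkQ
    have hfg : Function.Exact f.hom g := LinearMap.exact_map_mkQ_range f.hom
    have hS := ModuleCat.shortComplex_shortExact (ModuleCat.shortComplexOfCompEqZero f.hom g
      hfg.linearMap_comp_eq_zero) hfg hf (Submodule.mkQ_surjective _)
    have hI : Injective (Injective.under M) := inferInstance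
    exact .succ n M (ModuleCat.of R _) _ ((Module.injective_iff_injective_object R _).mpr hI) f
      (ModuleCat.ofHom g) hf hfg (Submodule.mkQ_surjective _)
      (ih ((hS.hasInjectiveDimensionLT_X₃_iff n hI).mpr h))

variable {x : R}

lemma exists_smul_eq_of_injective {I : Type u} [AddCommGroup I] [Module R I]
    (hI : Module.Injective R I) (hx : IsSMulRegular R x) (i : I) : ∃ j : I, x • j = i := by
  obtain ⟨h, hh⟩ := hI.out (LinearMap.lsmul R R x) hx (LinearMap.toSpanSingleton R I i)
  refine ⟨h 1, ?_⟩
  rw [← map_smul]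
  simpa using hh 1

lemma injective_torsionBy {I : Type u} [AddCommGroup I] [Module R I] (hI : Module.Injective R I) :
    Module.Injective (R ⧸ Ideal.span {x}) (Submodule.torsionBy R I x) := by
  refine ⟨fun X Y _ _ _ _ f hf g ↦ ?_⟩
  let _ := Module.compHom X (algebraMap R (R ⧸ Ideal.span {x}))
  let _ := Module.compHom Y (algebraMap R (R ⧸ Ideal.span {x}))
  have : IsScalarTower R (R ⧸ Ideal.span {x}) X := ⟨fun r s v ↦ by
    rw [Algebra.smul_def, mul_smul]; rfl⟩
  have : IsScalarTower R (R ⧸ Ideal.span {x}) Y := ⟨fun r s v ↦ by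
    rw [Algebra.smul_def, mul_smul]; rfl⟩
  obtain ⟨h, hh⟩ := hI.out (f.restrictScalars R) hf
    ((Submodule.torsionBy R I x).subtype ∘ₗ g.restrictScalars R)
  have hx (y : Y) : x • y = 0 := by
    rw [← algebraMap_smul (R ⧸ Ideal.span {x}) x y, Ideal.Quotient.algebraMap_eq,
      Ideal.Quotient.eq_zero_iff_mem.mpr (Ideal.mem_span_singleton_self x), zero_smul]
  refine ⟨LinearMap.extendScalarsOfSurjective Ideal.Quotient.mk_surjective
    (h.codRestrict (Submodule.torsionBy R I x) fun y ↦ by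
      rw [Submodule.mem_torsionBy_iff, ← map_smul, hx, map_zero]), fun v ↦ Subtype.ext (hh v)⟩

/-- The map induced on `x`-torsion submodules. -/
def torsionByMap {A B : Type u} [AddCommGroup A] [Module R A] [AddCommGroup B] [Module R B]
    (x : R) (f : A →ₗ[R] B) :
    Submodule.torsionBy R A x →ₗ[R ⧸ Ideal.span {x}] Submodule.torsionBy R B x :=
  LinearMap.extendScalarsOfSurjective Ideal.Quotient.mk_surjective
    (f.restrict fun a ha ↦ by
      rw [Submodule.mem_torsionBy_iff] at *
      rw [← map_smul, ha, map_zero])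

@[simp]
lemma coe_torsionByMap {A B : Type u} [AddCommGroup A] [Module R A] [AddCommGroup B] [Module R B]
    (f : A →ₗ[R] B) (a : Submodule.torsionBy R A x) : (torsionByMap x f a : B) = f a := rfl

section

variable {A B C : Type u} [AddCommGroup A] [Module R A] [AddCommGroup B] [Module R B]
  [AddCommGroup C] [Module R C] {f : A →ₗ[R] B} {g : B →ₗ[R] C}

lemma exact_torsionByMap (hf : Function.Injective f) (hfg : Function.Exact f g) :
    Function.Exact (torsionByMap x f) (torsionByMap x g) := by
  intro b
  constructor
  · intro hb
    obtain ⟨a, ha⟩ := (hfg b).mp (congrArg Subtype.val hb)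
    refine ⟨⟨a, (Submodule.mem_torsionBy_iff _ _).mpr (hf ?_)⟩, Subtype.ext ha⟩
    rw [map_smul, ha, map_zero]
    exact b.2
  · rintro ⟨a, rfl⟩
    exact Subtype.ext (hfg.apply_apply_eq_zero a)

lemma torsionByMap_surjective (hfg : Function.Exact f g)
    (hg : Function.Surjective g)
    (hA : ∀ a : A, ∃ a', x • a' = a) : Function.Surjective (torsionByMap x g) := by
  intro c
  obtain ⟨b, hb⟩ := hg c
  obtain ⟨a, ha⟩ := (hfg (x • b)).mp (by rw [map_smul, hb]; exact c.2)
  obtain ⟨a', rfl⟩ := hA a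
  refine ⟨⟨b - f a', (Submodule.mem_torsionBy_iff _ _).mpr ?_⟩, Subtype.ext ?_⟩
  · rw [smul_sub, ← map_smul, ha, sub_self]
  · rw [coe_torsionByMap, map_sub, hfg.apply_apply_eq_zero, sub_zero, hb]

end

lemma IdLE.torsionBy {n : ℕ} {M : ModuleCat.{u} R} (h : IdLE R n M) (hx : IsSMulRegular R x)
    (hdiv : ∀ m : M, ∃ m', x • m' = m) :
    IdLE (R ⧸ Ideal.span {x}) n
      (ModuleCat.of (R ⧸ Ideal.span {x}) (Submodule.torsionBy R M x)) := by
  induction h with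
  | zero M h => exact .zero _ (injective_torsionBy h)
  | succ n M C I hI f g hf hfg hg hC ih =>
    refine .succ n _ _ _ (injective_torsionBy hI) (ModuleCat.ofHom (torsionByMap x f.hom))
      (ModuleCat.ofHom (torsionByMap x g.hom)) ?_ (exact_torsionByMap hf hfg)
      (torsionByMap_surjective hfg hg hdiv) (ih fun c ↦ ?_)
    · exact fun a b hab ↦ Subtype.ext (hf (congrArg Subtype.val hab))
    · obtain ⟨i, rfl⟩ := hg c
      obtain ⟨j, rfl⟩ := exists_smul_eq_of_injective hI hx i
      exact ⟨g.hom j, (map_smul g.hom x j).symm⟩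

lemma IdLE.quotient {n : ℕ} (h : IdLE R (n + 1) (ModuleCat.of R R)) (hx : IsSMulRegular R x) :
    IdLE (R ⧸ Ideal.span {x}) n (ModuleCat.of (R ⧸ Ideal.span {x}) (R ⧸ Ideal.span {x})) := by
  cases h with
  | succ _ _ C I hI f g hf hfg hg hC =>
    have hdivI := exists_smul_eq_of_injective hI hx
    have hdivC (c : C) : ∃ c', x • c' = c := by
      obtain ⟨i, rfl⟩ := hg c
      obtain ⟨j, rfl⟩ := hdivI i
      exact ⟨g.hom j, (map_smul g.hom x j).symm⟩
    have hC' := (hC.torsionBy hx hdivC).hasInjectiveDimensionLT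
    have hI' := (IdLE.zero (R := R ⧸ Ideal.span {x})
      (ModuleCat.of _ (Submodule.torsionBy R I x)) (injective_torsionBy hI)).hasInjectiveDimensionLT
    have hι (A : ModuleCat.{u} R) :
        Function.Exact (Submodule.torsionBy R A x).subtype (LinearMap.lsmul R A x) := fun a ↦ by
      rw [Submodule.coe_subtype, Subtype.range_coe]
      exact (Submodule.mem_torsionBy_iff x a).symm
    have hπ : Function.Exact (LinearMap.lsmul R R x) (Submodule.mkQ (Ideal.span {x})) := fun r ↦ by
      exact Ideal.Quotient.eq_zero_iff_mem.trans
        (Ideal.mem_span_singleton.trans (exists_congr fun _ ↦ eq_comm))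
    have hcomm {A B : ModuleCat.{u} R} (φ : A ⟶ B) : φ.hom ∘ₗ LinearMap.lsmul R A x =
        LinearMap.lsmul R B x ∘ₗ φ.hom := LinearMap.ext fun a ↦ map_smul φ.hom x a
    let δ : Submodule.torsionBy R C x →ₗ[R] R ⧸ Ideal.span {x} :=
      SnakeLemma.δ' (LinearMap.lsmul R R x) (LinearMap.lsmul R I x) (LinearMap.lsmul R C x)
        f.hom g.hom hfg f.hom g.hom hfg (hcomm f) (hcomm g) _ (hι C) _ hπ hg hf
    have hδ₁ : Function.Exact ((torsionByMap x g.hom).restrictScalars R) δ :=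
      SnakeLemma.exact_δ'_right _ _ _ _ _ hfg _ _ hfg (hcomm f) (hcomm g) _ (hι I) _ (hι C) _ hπ
        hg hf _ rfl Subtype.val_injective
    have hδ₂ : Function.Surjective δ := by
      intro s
      obtain ⟨r, rfl⟩ := Ideal.Quotient.mk_surjective s
      obtain ⟨j, hj⟩ := hdivI (f.hom r)
      refine ⟨⟨g.hom j, (Submodule.mem_torsionBy_iff _ _).mpr ?_⟩, ?_⟩
      · rw [← map_smul, hj]
        exact hfg.apply_apply_eq_zero r
      · exact SnakeLemma.δ'_eq _ _ _ _ _ hfg _ _ hfg (hcomm f) (hcomm g) _ (hι C) _ hπ hg hf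
          _ j rfl r hj.symm
    let δ' : Submodule.torsionBy R C x →ₗ[R ⧸ Ideal.span {x}] R ⧸ Ideal.span {x} :=
      LinearMap.extendScalarsOfSurjective Ideal.Quotient.mk_surjective δ
    have hinj : Function.Injective (torsionByMap x g.hom) := by
      rw [injective_iff_map_eq_zero]
      rintro ⟨i, hi⟩ hgi
      obtain ⟨r, rfl⟩ := (hfg i).mp (congrArg Subtype.val hgi)
      have hr : r = 0 := hx (hf (by
        change f.hom (x • r) = f.hom (x • 0)
        rw [map_smul, smul_zero, map_zero]
        exact hi))
      exact Subtype.ext ((congrArg f.hom hr).trans (map_zero f.hom))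
    have hS := ModuleCat.shortComplex_shortExact (ModuleCat.shortComplexOfCompEqZero
      (torsionByMap x g.hom) δ' (Function.Exact.linearMap_comp_eq_zero hδ₁)) hδ₁ hinj hδ₂
    refine IdLE.of_hasInjectiveDimensionLT (hS.hasInjectiveDimensionLT_X₃ (n + 1) hC' ?_)
    exact hasInjectiveDimensionLT_of_ge _ 1 _ (by omega)

end InjectiveDimension

section DepthFormula

open TensorProduct IsLocalRing

/-- The depth formula holds for all nonzero finitely generated Tor-independent modules over `R`. -/
def DepthFormulaHolds (R : Type u) [CommRing R] [IsLocalRing R] : Prop :=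
  ∀ (A B : Type u) [AddCommGroup A] [Module R A] [AddCommGroup B] [Module R B],
    Module.Finite R A → Module.Finite R B → Nontrivial A → Nontrivial B → TorIndep R A B →
    eDepth R A + eDepth R B = eDepth R R + eDepth R (A ⊗[R] B)

variable {R : Type u} [CommRing R] [IsLocalRing R]

lemma exists_surjective_residueField (M : Type u) [AddCommGroup M] [Module R M]
    [Module.Finite R M] [Nontrivial M] :
    ∃ f : M →ₗ[R] ResidueField R, Function.Surjective f := by
  obtain ⟨I, f, hI, hf⟩ := Module.exists_surjective_quotient_of_finite R M
  exact ⟨(Submodule.factor (le_maximalIdeal hI)).comp f,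
    (Submodule.factor_surjective (le_maximalIdeal hI)).comp hf⟩

lemma nontrivial_tensorProduct_of_finite (M N : Type u) [AddCommGroup M] [Module R M]
    [AddCommGroup N] [Module R N] [Module.Finite R M] [Module.Finite R N] [Nontrivial M]
    [Nontrivial N] : Nontrivial (M ⊗[R] N) := by
  obtain ⟨f, hf⟩ := exists_surjective_residueField (R := R) M
  obtain ⟨g, hg⟩ := exists_surjective_residueField (R := R) N
  have : Function.Surjective
      ((LinearMap.mul' R (ResidueField R)).comp (TensorProduct.map f g)) := by
    intro z
    obtain ⟨x, rfl⟩ := hf z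
    obtain ⟨y, hy⟩ := hg 1
    exact ⟨x ⊗ₜ y, by simp [hy]⟩
  exact this.nontrivial

lemma one_le_eDepth_prod {A B : Type u} [AddCommGroup A] [Module R A] [AddCommGroup B] [Module R B]
    (hA : 1 ≤ eDepth R A) (hB : 1 ≤ eDepth R B) : 1 ≤ eDepth R (A × B) :=
  natCast_le_eDepth_middle (n := 1) LinearMap.inl_injective Function.Exact.inl_snd
    Prod.snd_surjective hA hB

lemma isLocalRing_quotient_span_singleton {x : R} (hx : x ∈ maximalIdeal R) :
    IsLocalRing (R ⧸ Ideal.span {x}) := by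
  have : Nontrivial (R ⧸ Ideal.span {x}) := by
    rw [Ideal.Quotient.nontrivial_iff, Ne, Ideal.span_singleton_eq_top]
    exact hx
  exact IsLocalRing.of_surjective' (Ideal.Quotient.mk _) Ideal.Quotient.mk_surjective

variable [IsNoetherianRing R]

lemma exists_eDepth_eq_natCast (M : Type u) [AddCommGroup M] [Module R M] [Module.Finite R M]
    [Nontrivial M] : ∃ n : ℕ, eDepth R M = n :=
  ENat.ne_top_iff_exists.mp (eDepth_ne_top M) |>.imp fun _ ↦ Eq.symm

lemma eDepth_baseChange_quotient_add_one {x : R} (hx : x ∈ maximalIdeal R)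
    [IsLocalRing (R ⧸ Ideal.span {x})] {M : Type u} [AddCommGroup M] [Module R M]
    [Module.Finite R M] [Nontrivial M] (hM : IsSMulRegular M x) :
    eDepth (R ⧸ Ideal.span {x}) ((R ⧸ Ideal.span {x}) ⊗[R] M) + 1 = eDepth R M := by
  have : Nontrivial (QuotSMulTop x M) := nontrivial_quotSMulTop_of_mem_maximalIdeal M hx
  have e := QuotSMulTop.equivQuotTensor x M
  have : Nontrivial ((R ⧸ Ideal.span {x}) ⊗[R] M) := e.symm.toEquiv.nontrivial
  rw [eDepth_of_surjective_algebraMap (R := R) _ Ideal.Quotient.mk_surjective, ← eDepth_congr e]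
  obtain ⟨a, ha⟩ := exists_eDepth_eq_natCast (R := R) M
  obtain ⟨b, hb⟩ := exists_eDepth_eq_natCast (R := R) (QuotSMulTop x M)
  have key (n : ℕ) := natCast_le_eDepth_quotSMulTop_iff hx hM n
  rw [ha, hb] at key ⊢
  norm_cast at key ⊢
  have := key b
  have := key (a - 1)
  have := key a
  omega

lemma eDepth_quotient_add_one {x : R} (hx : x ∈ maximalIdeal R)
    [IsLocalRing (R ⧸ Ideal.span {x})] (hR : IsSMulRegular R x) :
    eDepth (R ⧸ Ideal.span {x}) (R ⧸ Ideal.span {x}) + 1 = eDepth R R := by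
  rw [← eDepth_baseChange_quotient_add_one hx hR,
    eDepth_congr (AlgebraTensorModule.rid R (R ⧸ Ideal.span {x}) (R ⧸ Ideal.span {x}))]

/-- The hypothesis that the depth formula holds modulo every regular element. -/
def DepthFormulaHoldsModRegular (R : Type u) [CommRing R] [IsLocalRing R] : Prop :=
  ∀ x ∈ maximalIdeal R, IsSMulRegular R x → ∀ [IsLocalRing (R ⧸ Ideal.span {x})],
    DepthFormulaHolds (R ⧸ Ideal.span {x})

section

variable {M N : Type u} [AddCommGroup M] [Module R M] [AddCommGroup N] [Module R N]

/-- A first syzygy `K` of `M`, with the resulting depth inequalities for `K` and `K ⊗ N`. -/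
lemma exists_syzygy_of_torIndep [Module.Finite R M] (h : TorIndep R M N) :
    ∃ (K : Type u) (_ : AddCommGroup K) (_ : Module R K), Module.Finite R K ∧ TorIndep R K N ∧
      (∀ n : ℕ, (n + 1 : ℕ) ≤ eDepth R R → n ≤ eDepth R M → (n + 1 : ℕ) ≤ eDepth R K) ∧
      (∀ n : ℕ, n ≤ eDepth R R → (n + 1 : ℕ) ≤ eDepth R K → n ≤ eDepth R M) ∧
      (∀ n : ℕ, (n + 1 : ℕ) ≤ eDepth R N → n ≤ eDepth R (M ⊗[R] N) →
        (n + 1 : ℕ) ≤ eDepth R (K ⊗[R] N)) ∧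
      (∀ n : ℕ, n ≤ eDepth R N → (n + 1 : ℕ) ≤ eDepth R (K ⊗[R] N) →
        n ≤ eDepth R (M ⊗[R] N)) := by
  obtain ⟨m, p, hp⟩ := Module.Finite.exists_fin' R M
  have hk : Function.Injective (LinearMap.ker p).subtype := Subtype.val_injective
  have hkp : Function.Exact (LinearMap.ker p).subtype p := LinearMap.exact_subtype_ker_map p
  have hkN := rTensor_injective_of_subsingleton_torMod_one hk hkp hp (h 1 le_rfl)
  have hkpN := rTensor_exact N hkp hp
  have hpN := LinearMap.rTensor_surjective N hp
  refine ⟨LinearMap.ker p, inferInstance, inferInstance, inferInstance,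
    h.syzygy_left hk hkp hp, fun n hR hM ↦ ?_, fun n hR hK ↦ ?_, fun n hN hMN ↦ ?_,
    fun n hN hKN ↦ ?_⟩
  · exact natCast_succ_le_eDepth_left hk hkp hp (natCast_le_eDepth_pi hR m) hM
  · exact natCast_le_eDepth_right hk hkp hp (natCast_le_eDepth_pi hR m) hK
  · exact natCast_succ_le_eDepth_left hkN hkpN hpN (natCast_le_eDepth_free_tensor hN m) hMN
  · exact natCast_le_eDepth_right hkN hkpN hpN (natCast_le_eDepth_free_tensor hN m) hKN

variable (hQ : DepthFormulaHoldsModRegular R) (hR : 2 ≤ eDepth R R)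
  [Module.Finite R M] [Module.Finite R N] [Nontrivial M] [Nontrivial N] (h : TorIndep R M N)

include hQ h

lemma DepthFormulaHoldsModRegular.depth_formula_of_one_le (hR : 1 ≤ eDepth R R)
    (hM : 1 ≤ eDepth R M) (hN : 1 ≤ eDepth R N) (hMN : 1 ≤ eDepth R (M ⊗[R] N)) :
    eDepth R M + eDepth R N = eDepth R R + eDepth R (M ⊗[R] N) := by
  have := nontrivial_tensorProduct_of_finite (R := R) M N
  obtain ⟨x, hx, hreg⟩ := one_le_eDepth_iff_exists_isSMulRegular.mp
    (one_le_eDepth_prod hR (one_le_eDepth_prod hM (one_le_eDepth_prod hN hMN)))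
  have hx₁ : IsSMulRegular R x := hreg.of_injective _ LinearMap.inl_injective
  have hreg := hreg.of_injective _ (LinearMap.inr_injective (R := R))
  have hxM : IsSMulRegular M x := hreg.of_injective _ (LinearMap.inl_injective (R := R))
  have hreg := hreg.of_injective _ (LinearMap.inr_injective (R := R))
  have hxN : IsSMulRegular N x := hreg.of_injective _ (LinearMap.inl_injective (R := R))
  have hxMN := hreg.of_injective _ (LinearMap.inr_injective (R := R))
  have := isLocalRing_quotient_span_singleton hx
  have nt (A : Type u) [AddCommGroup A] [Module R A] [Module.Finite R A] [Nontrivial A] :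
      Nontrivial ((R ⧸ Ideal.span {x}) ⊗[R] A) :=
    nontrivial_tensorProduct_of_finite _ _
  have hS := hQ x hx hx₁ ((R ⧸ Ideal.span {x}) ⊗[R] M) ((R ⧸ Ideal.span {x}) ⊗[R] N)
    inferInstance inferInstance (nt M) (nt N) (h.baseChange_quotient hx₁ hxM hxN hxMN)
  have e := AlgebraTensorModule.distribBaseChange R (R ⧸ Ideal.span {x}) M N
  rw [← eDepth_congr (B := ((R ⧸ Ideal.span {x}) ⊗[R] M) ⊗[R ⧸ Ideal.span {x}]
    ((R ⧸ Ideal.span {x}) ⊗[R] N)) e] at hS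
  rw [← eDepth_quotient_add_one hx hx₁, ← eDepth_baseChange_quotient_add_one hx hxM,
    ← eDepth_baseChange_quotient_add_one hx hxN, ← eDepth_baseChange_quotient_add_one hx hxMN,
    add_add_add_comm, hS, add_add_add_comm]

include hR

lemma DepthFormulaHoldsModRegular.depth_add_or_of_depth_tensor_eq_zero (hM : 1 ≤ eDepth R M)
    (hN : 1 ≤ eDepth R N) (hMN : eDepth R (M ⊗[R] N) = 0) :
    eDepth R M + eDepth R N = eDepth R R ∨ eDepth R R ≤ eDepth R M ∧ eDepth R N ≤ 1 := by
  obtain ⟨K, _, _, _, hKN, h₁, h₂, h₃, h₄⟩ := exists_syzygy_of_torIndep h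
  obtain ⟨a, ha⟩ := exists_eDepth_eq_natCast (R := R) M
  obtain ⟨b, hb⟩ := exists_eDepth_eq_natCast (R := R) N
  obtain ⟨d, hd⟩ := exists_eDepth_eq_natCast (R := R) R
  rcases subsingleton_or_nontrivial K with hK | hK
  · have := h₄ 1 (mod_cast hN) (by rw [eDepth_eq_top_of_subsingleton]; exact le_top)
    rw [hMN] at this
    norm_cast at this
  have := nontrivial_tensorProduct_of_finite (R := R) K N
  obtain ⟨k, hk⟩ := exists_eDepth_eq_natCast (R := R) K
  obtain ⟨s, hs⟩ := exists_eDepth_eq_natCast (R := R) (K ⊗[R] N)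
  have hf := hQ.depth_formula_of_one_le hKN (one_le_two.trans hR)
  rw [hMN] at h₃ h₄
  simp only [ha, hb, hd, hk, hs] at hR hM hN hf h₁ h₂ h₃ h₄ ⊢
  norm_cast at hR hM hN hf h₁ h₂ h₃ h₄ ⊢
  have := h₁ a
  have := h₁ (d - 1)
  have := h₂ (a + 1)
  have := h₃ 0
  have := h₄ 1
  omega

lemma DepthFormulaHoldsModRegular.depth_formula_of_one_le_left_right (hM : 1 ≤ eDepth R M)
    (hN : 1 ≤ eDepth R N) :
    eDepth R M + eDepth R N = eDepth R R + eDepth R (M ⊗[R] N) := by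
  rcases eq_or_ne (eDepth R (M ⊗[R] N)) 0 with hMN | hMN
  · rw [hMN, add_zero]
    obtain h' | ⟨-, hN'⟩ := hQ.depth_add_or_of_depth_tensor_eq_zero hR h hM hN hMN
    · exact h'
    obtain h' | ⟨hN'', -⟩ := hQ.depth_add_or_of_depth_tensor_eq_zero hR h.symm hN hM
      (by rwa [eDepth_congr (TensorProduct.comm R N M)])
    · rwa [add_comm]
    · exact absurd (hR.trans (hN''.trans hN')) (by norm_num)
  · exact hQ.depth_formula_of_one_le h (one_le_two.trans hR) hM hN
      (Order.one_le_iff_ne_zero.mpr hMN)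

lemma DepthFormulaHoldsModRegular.depth_formula_of_one_le_right (hN : 1 ≤ eDepth R N) :
    eDepth R M + eDepth R N = eDepth R R + eDepth R (M ⊗[R] N) := by
  rcases eq_or_ne (eDepth R M) 0 with hM | hM
  swap
  · exact hQ.depth_formula_of_one_le_left_right hR h (Order.one_le_iff_ne_zero.mpr hM) hN
  obtain ⟨K, _, _, _, hKN, h₁, h₂, h₃, h₄⟩ := exists_syzygy_of_torIndep h
  have := nontrivial_tensorProduct_of_finite (R := R) M N
  obtain ⟨b, hb⟩ := exists_eDepth_eq_natCast (R := R) N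
  obtain ⟨d, hd⟩ := exists_eDepth_eq_natCast (R := R) R
  obtain ⟨t, ht⟩ := exists_eDepth_eq_natCast (R := R) (M ⊗[R] N)
  rcases subsingleton_or_nontrivial K with hK | hK
  · have := h₂ 1 (one_le_two.trans hR) (by rw [eDepth_eq_top_of_subsingleton]; exact le_top)
    rw [hM] at this
    norm_cast at this
  have := nontrivial_tensorProduct_of_finite (R := R) K N
  obtain ⟨k, hk⟩ := exists_eDepth_eq_natCast (R := R) K
  obtain ⟨s, hs⟩ := exists_eDepth_eq_natCast (R := R) (K ⊗[R] N)
  have hf := hQ.depth_formula_of_one_le_left_right hR hKN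
  simp only [hM, hb, hd, hk, hs, ht] at hR hN hf h₁ h₂ h₃ h₄ ⊢
  norm_cast at hR hN hf h₁ h₂ h₃ h₄ ⊢
  have := h₁ 0
  have := h₂ 1
  have := h₃ s
  have := h₄ (s - 1)
  omega

/-- If the depth formula holds modulo every regular element and `depth R ≥ 2`, it holds
over `R`. -/
lemma DepthFormulaHoldsModRegular.depth_formula :
    eDepth R M + eDepth R N = eDepth R R + eDepth R (M ⊗[R] N) := by
  rcases eq_or_ne (eDepth R N) 0 with hN | hN
  swap
  · exact hQ.depth_formula_of_one_le_right hR h (Order.one_le_iff_ne_zero.mpr hN)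
  rcases eq_or_ne (eDepth R M) 0 with hM | hM
  swap
  · rw [add_comm, eDepth_congr (TensorProduct.comm R M N)]
    exact hQ.depth_formula_of_one_le_right hR h.symm (Order.one_le_iff_ne_zero.mpr hM)
  obtain ⟨K, _, _, _, hKN, h₁, h₂, -, -⟩ := exists_syzygy_of_torIndep h
  rcases subsingleton_or_nontrivial K with hK | hK
  · have := h₂ 1 (one_le_two.trans hR) (by rw [eDepth_eq_top_of_subsingleton]; exact le_top)
    rw [hM] at this
    norm_cast at this
  have := nontrivial_tensorProduct_of_finite (R := R) N K
  obtain ⟨d, hd⟩ := exists_eDepth_eq_natCast (R := R) R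
  obtain ⟨k, hk⟩ := exists_eDepth_eq_natCast (R := R) K
  obtain ⟨s, hs⟩ := exists_eDepth_eq_natCast (R := R) (N ⊗[R] K)
  have hf := hQ.depth_formula_of_one_le_right hR hKN.symm
  simp only [hM, hN, hd, hk, hs] at hR hf h₁ h₂
  norm_cast at hR hf h₁ h₂
  have := h₁ 0
  have := h₂ 1
  omega

end

/-- The depth formula over all Gorenstein local rings of depth one implies it over all Gorenstein
local rings of positive depth, by induction on the injective dimension. -/
lemma depthFormulaHolds_of_idLE
    (H : ∀ (S : Type u) [CommRing S] [IsNoetherianRing S] [IsLocalRing S],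
      (∃ n : ℕ, IdLE S n (ModuleCat.of S S)) → eDepth S S = 1 → DepthFormulaHolds S)
    (n : ℕ) (R : Type u) [CommRing R] [IsNoetherianRing R] [IsLocalRing R]
    (hn : IdLE R n (ModuleCat.of R R)) (hR : 1 ≤ eDepth R R) : DepthFormulaHolds R := by
  induction n generalizing R with
  | zero =>
    obtain ⟨x, hx, hreg⟩ := one_le_eDepth_iff_exists_isSMulRegular.mp hR
    obtain ⟨-, hI⟩ := hn
    obtain ⟨y, hy⟩ := exists_smul_eq_of_injective hI hreg (1 : R)
    exact absurd (IsUnit.of_mul_eq_one y hy) hx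
  | succ n ih =>
    rcases hR.eq_or_lt with hR | hR
    · exact H R ⟨_, hn⟩ hR.symm
    replace hR : 2 ≤ eDepth R R := by
      rw [← one_add_one_eq_two]
      exact Order.add_one_le_of_lt hR
    have hQ : DepthFormulaHoldsModRegular R := by
      intro x hx hreg _
      refine ih _ (hn.quotient hreg) ?_
      rw [← eDepth_quotient_add_one hx hreg, ← one_add_one_eq_two] at hR
      exact (ENat.add_le_add_iff_right ENat.one_ne_top).mp hR
    intro M N _ _ _ _ _ _ _ _ h
    exact hQ.depth_formula hR h

end DepthFormula

/-- if the depth formula holds for all nonzero Tor-independent pairs over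
every depth-one Gorenstein local ring, then it holds over every Gorenstein local ring of
positive depth. -/
theorem stmt_16
    (H : ∀ (S : Type u) [CommRing S] [IsNoetherianRing S] [IsLocalRing S],
      (∃ n : ℕ, IdLE S n (ModuleCat.of S S)) → eDepth S S = 1 →
      ∀ (A B : Type u) [AddCommGroup A] [Module S A] [AddCommGroup B] [Module S B],
        Module.Finite S A → Module.Finite S B → Nontrivial A → Nontrivial B →
        TorIndep S A B →
        eDepth S A + eDepth S B = eDepth S S + eDepth S (TensorProduct S A B))
    (R : Type u) [CommRing R] [IsNoetherianRing R] [IsLocalRing R]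
    (hGor : ∃ n : ℕ, IdLE R n (ModuleCat.of R R)) (hd : 0 < eDepth R R)
    (M N : Type u) [AddCommGroup M] [Module R M] [AddCommGroup N] [Module R N]
    [Module.Finite R M] [Module.Finite R N] [Nontrivial M] [Nontrivial N]
    (hTI : TorIndep R M N) :
    eDepth R M + eDepth R N = eDepth R R + eDepth R (TensorProduct R M N) :=
  depthFormulaHolds_of_idLE H hGor.choose R hGor.choose_spec (Order.one_le_iff_pos.mpr hd) M N
    inferInstance inferInstance inferInstance inferInstance hTI
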